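/- Let θ be a real number, let G₁ and G₂ be disjoint θ-super positive graphs, and let v₁ ∈ V(G₁), v₂ ∈ V(G₂). Then the graph G obtained from the disjoint union G₁ ∪ G₂ by adding the edge (v₁,v₂) is θ-super positive. -/

import Mathlib

open Polynomial

namespace MatchPoly

variable {V : Type*}

/-- The number of `r`-matchings in `G`: sets of `r` edges, no two sharing a vertex. -/
noncomputable def numMatchings (G : SimpleGraph V) (r : ℕ) : ℕ :=
  Nat.card {M : Finset (Sym2 V) // M.card = r ∧ (M : Set (Sym2 V)) ⊆ G.edgeSet ∧
    (M : Set (Sym2 V)).Pairwise fun e f => ∀ v : V, v ∈ e → v ∉ f}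

/-- The matching polynomial `μ(G,x) = ∑ (-1)^r p(G,r) x^(n-2r)`. -/
noncomputable def matchingPoly (G : SimpleGraph V) : Polynomial ℝ :=
  ∑ r ∈ Finset.range (Nat.card V + 1),
    Polynomial.C ((-1 : ℝ) ^ r * (numMatchings G r : ℝ)) *
      (Polynomial.X : Polynomial ℝ) ^ (Nat.card V - 2 * r)

/-- `mult θ G`: the multiplicity of `θ` as a root of `μ(G,x)`. -/
noncomputable def mult (θ : ℝ) (G : SimpleGraph V) : ℕ :=
  (matchingPoly G).rootMultiplicity θ

/-- `G \ X`: the induced subgraph on the complement of the vertex set `X`. -/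
def deleteSet (G : SimpleGraph V) (X : Set V) : SimpleGraph ↥(Xᶜ) :=
  G.induce (Xᶜ)

/-- `G \ v`: delete a single vertex. -/
def deleteVert (G : SimpleGraph V) (v : V) : SimpleGraph ↥({v}ᶜ : Set V) :=
  G.induce ({v}ᶜ : Set V)

/-- `u` is θ-essential: `mult(θ, G\u) = mult(θ,G) - 1`. -/
def IsEssential (θ : ℝ) (G : SimpleGraph V) (u : V) : Prop :=
  mult θ (deleteVert G u) + 1 = mult θ G

/-- `u` is θ-neutral: `mult(θ, G\u) = mult(θ,G)`. -/
def IsNeutral (θ : ℝ) (G : SimpleGraph V) (u : V) : Prop :=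
  mult θ (deleteVert G u) = mult θ G

/-- `u` is θ-positive: `mult(θ, G\u) = mult(θ,G) + 1`. -/
def IsPositive (θ : ℝ) (G : SimpleGraph V) (u : V) : Prop :=
  mult θ (deleteVert G u) = mult θ G + 1

/-- `u` is θ-special: not θ-essential but adjacent to a θ-essential vertex. -/
def IsSpecial (θ : ℝ) (G : SimpleGraph V) (u : V) : Prop :=
  ¬ IsEssential θ G u ∧ ∃ w : V, G.Adj u w ∧ IsEssential θ G w

/-- `A_θ(G)`: the set of θ-special vertices. -/
def specialSet (θ : ℝ) (G : SimpleGraph V) : Set V := {u | IsSpecial θ G u}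

/-- `N_θ(G)`: the set of θ-neutral vertices. -/
def neutralSet (θ : ℝ) (G : SimpleGraph V) : Set V := {u | IsNeutral θ G u}

/-- `P_θ(G)`: the set of θ-positive vertices that are not θ-special. -/
def positiveSet (θ : ℝ) (G : SimpleGraph V) : Set V :=
  {u | IsPositive θ G u ∧ ¬ IsSpecial θ G u}

/-- `G` is θ-super positive: `mult(θ,G) = 0` and `mult(θ,G\v) = 1` for every vertex `v`. -/
def IsSuperPositive (θ : ℝ) (G : SimpleGraph V) : Prop :=
  mult θ G = 0 ∧ ∀ v : V, mult θ (deleteVert G v) = 1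

/-- `G` is θ-elementary: θ-super positive and `P_θ(G\v) = ∅` for every vertex `v`. -/
def IsElementary (θ : ℝ) (G : SimpleGraph V) : Prop :=
  IsSuperPositive θ G ∧ ∀ v : V, positiveSet θ (deleteVert G v) = ∅

/-- `G` is θ-critical: every vertex is θ-essential and `mult(θ,G) = 1`. -/
def IsCritical (θ : ℝ) (G : SimpleGraph V) : Prop :=
  (∀ v : V, IsEssential θ G v) ∧ mult θ G = 1

/-- `c_θ(G)`: the number of θ-critical connected components of `G`. -/
noncomputable def numCritComponents (θ : ℝ) (G : SimpleGraph V) : ℕ :=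
  Nat.card {c : G.ConnectedComponent // IsCritical θ (G.induce c.supp)}

/-- `X` is a θ-barrier set: `mult(θ,G) = c_θ(G\X) - |X|`. -/
def IsBarrier (θ : ℝ) (G : SimpleGraph V) (X : Set V) : Prop :=
  numCritComponents θ (deleteSet G X) = mult θ G + X.ncard

/-- `X` is a θ-extreme set: `mult(θ,G\X) = mult(θ,G) + |X|`. -/
def IsExtreme (θ : ℝ) (G : SimpleGraph V) (X : Set V) : Prop :=
  mult θ (deleteSet G X) = mult θ G + X.ncard

/-- `G` is θ-base: θ-super positive and no θ-barrier set contains two adjacent vertices. -/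
def IsBase (θ : ℝ) (G : SimpleGraph V) : Prop :=
  IsSuperPositive θ G ∧
    ∀ X : Set V, IsBarrier θ G X → ∀ u v : V, u ∈ X → v ∈ X → ¬ G.Adj u v

open scoped Classical in
/-- The matchings of `G` all of whose edges lie inside the vertex set `S`. -/
noncomputable def matchingsIn {V : Type*} [Fintype V] (G : SimpleGraph V) (S : Finset V) :
    Finset (Finset (Sym2 V)) :=
  {M | (∀ e ∈ M, e ∈ G.edgeSet ∧ ∀ v ∈ e, v ∈ S) ∧
    (M : Set (Sym2 V)).Pairwise fun e f => ∀ v : V, v ∈ e → v ∉ f}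

/-- The matching polynomial of the subgraph of `G` induced on `S`, computed inside `G`. -/
noncomputable def matchingPolyIn {V : Type*} [Fintype V] (G : SimpleGraph V) (S : Finset V) :
    ℝ[X] :=
  ∑ M ∈ matchingsIn G S, C ((-1 : ℝ) ^ M.card) * X ^ (S.card - 2 * M.card)

section Ambient

variable {V : Type*} [Fintype V] {G : SimpleGraph V} {S T : Finset V}

lemma mem_matchingsIn {M : Finset (Sym2 V)} :
    M ∈ matchingsIn G S ↔ (∀ e ∈ M, e ∈ G.edgeSet ∧ ∀ v ∈ e, v ∈ S) ∧
      (M : Set (Sym2 V)).Pairwise fun e f => ∀ v : V, v ∈ e → v ∉ f := by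
  simp [matchingsIn]

lemma two_mul_card_le_of_mem_matchingsIn {M : Finset (Sym2 V)} (hM : M ∈ matchingsIn G S) :
    2 * M.card ≤ S.card := by
  classical
  rw [mem_matchingsIn] at hM
  have hdisj : (M : Set (Sym2 V)).PairwiseDisjoint Sym2.toFinset := by
    intro e he f hf hef
    refine Finset.disjoint_left.2 fun v hv hv' => ?_
    exact hM.2 he hf hef v (by simpa using hv) (by simpa using hv')
  calc 2 * M.card = ∑ e ∈ M, e.toFinset.card := by
        rw [Finset.sum_congr rfl fun e he => Sym2.card_toFinset_of_not_isDiag e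
          (G.not_isDiag_of_mem_edgeSet (hM.1 e he).1)]
        simp [mul_comm]
    _ = (M.biUnion Sym2.toFinset).card := (Finset.card_biUnion hdisj).symm
    _ ≤ S.card := by
        refine Finset.card_le_card fun v hv => ?_
        obtain ⟨e, he, hv⟩ := Finset.mem_biUnion.1 hv
        exact (hM.1 e he).2 v (by simpa using hv)

/-- The matching polynomial of a graph embedded in `G` depends only on the image of its
vertex set. -/
lemma matchingPoly_eq_matchingPolyIn {W : Type*} [Fintype W] {H : SimpleGraph W} (f : H ↪g G)
    (hS : ∀ v, v ∈ S ↔ ∃ w, f w = v) : matchingPoly H = matchingPolyIn G S := by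
  classical
  have hSmap : S = Finset.univ.map f.toEmbedding := by
    ext v; simp [hS]
  have hcard : Nat.card W = S.card := by simp [hSmap]
  have hnum (r : ℕ) : numMatchings H r = {M ∈ matchingsIn G S | M.card = r}.card := by
    rw [numMatchings, Nat.subtype_card
      ((matchingsIn H (Finset.univ : Finset W)).filter fun M => M.card = r)
      (by intro M; simp [mem_matchingsIn, Set.subset_def]; tauto)]
    refine Finset.card_bij (fun M _ => M.map f.toEmbedding.sym2Map) ?_ ?_ ?_
    · intro M hM
      simp only [Finset.mem_filter, mem_matchingsIn, Finset.card_map] at hM ⊢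
      refine ⟨⟨?_, ?_⟩, hM.2⟩
      · intro e he
        obtain ⟨e, heM, rfl⟩ := Finset.mem_map.1 he
        have := (hM.1.1 e heM).1
        induction e with | _ a b
        simpa [hS] using this
      · intro e he e' he' hne v hv hv'
        obtain ⟨e, heM, rfl⟩ := Finset.mem_map.1 he
        obtain ⟨e', heM', rfl⟩ := Finset.mem_map.1 he'
        obtain ⟨a, ha, rfl⟩ := Sym2.mem_map.1 hv
        obtain ⟨b, hb, hab⟩ := Sym2.mem_map.1 hv'
        obtain rfl := f.injective hab
        exact hM.1.2 heM heM' (fun h => hne (by rw [h])) b ha hb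
    · intro M _ M' _ h
      exact Finset.map_injective _ h
    · intro M hM
      simp only [Finset.mem_filter, mem_matchingsIn] at hM
      have hpre : ∀ e ∈ M, ∃ e', f.toEmbedding.sym2Map e' = e := by
        intro e he
        have := (hM.1.1 e he).2
        induction e with | _ a b
        obtain ⟨a, rfl⟩ := (hS _).1 (this a (by simp))
        obtain ⟨b, rfl⟩ := (hS _).1 (this b (by simp))
        exact ⟨s(a, b), rfl⟩
      have himg : (M.preimage f.toEmbedding.sym2Map
          f.toEmbedding.sym2Map.injective.injOn).map f.toEmbedding.sym2Map = M := by
        ext e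
        simp only [Finset.mem_map, Finset.mem_preimage]
        constructor
        · rintro ⟨e, he, rfl⟩; exact he
        · intro he
          obtain ⟨e', rfl⟩ := hpre e he
          exact ⟨e', he, rfl⟩
      refine ⟨_, ?_, himg⟩
      simp only [Finset.mem_filter, mem_matchingsIn, Finset.mem_univ, implies_true, and_true,
        Finset.mem_preimage]
      refine ⟨⟨?_, ?_⟩, ?_⟩
      · intro e he
        have := (hM.1.1 _ he).1
        induction e with | _ a b
        simpa using this
      · intro e he e' he' hne v hv hv'
        refine hM.1.2 (Finset.mem_preimage.1 he) (Finset.mem_preimage.1 he')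
          (fun h => hne (f.toEmbedding.sym2Map.injective h)) (f v) ?_ ?_
        · exact Sym2.mem_map.2 ⟨v, hv, rfl⟩
        · exact Sym2.mem_map.2 ⟨v, hv', rfl⟩
      · rw [← hM.2, ← Finset.card_map, himg]
  rw [matchingPoly, matchingPolyIn, hcard, ← Finset.sum_fiberwise_of_maps_to
    (g := Finset.card) (t := Finset.range (S.card + 1))]
  · refine Finset.sum_congr rfl fun r _ => ?_
    rw [Finset.sum_congr rfl (g := fun _ => C ((-1 : ℝ) ^ r) * X ^ (S.card - 2 * r)), hnum]
    · simp only [Finset.sum_const, nsmul_eq_mul, map_mul, map_natCast]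
      ring
    · intro M hM
      rw [(Finset.mem_filter.1 hM).2]
  · intro M hM
    have := two_mul_card_le_of_mem_matchingsIn hM
    simp only [Finset.mem_range]
    omega

lemma matchingPolyIn_empty : matchingPolyIn G ∅ = 1 := by
  have : matchingsIn G ∅ = {∅} := by
    ext M
    rw [Finset.mem_singleton]
    constructor
    · intro hM
      have := two_mul_card_le_of_mem_matchingsIn hM
      rw [← Finset.card_eq_zero]
      simpa using this
    · rintro rfl
      simp [mem_matchingsIn]
  simp [matchingPolyIn, this]

variable [DecidableEq V]

lemma matchingsIn_eq_union [DecidableRel G.Adj] {u : V} (hu : u ∈ S) :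
    matchingsIn G S = matchingsIn G (S.erase u) ∪ ((S.erase u).filter (G.Adj u)).biUnion
      fun w => (matchingsIn G ((S.erase u).erase w)).image (insert s(u, w)) := by
  ext M
  simp only [Finset.mem_union, Finset.mem_biUnion, Finset.mem_image, Finset.mem_filter]
  constructor
  · intro hM
    rw [mem_matchingsIn] at hM
    by_cases h : ∃ e ∈ M, u ∈ e
    · right
      obtain ⟨e, he, w, rfl⟩ := h
      have hadj := (hM.1 _ he).1
      rw [SimpleGraph.mem_edgeSet] at hadj
      refine ⟨w, ⟨Finset.mem_erase.2 ⟨hadj.ne', (hM.1 _ he).2 w (by simp)⟩, hadj⟩,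
        M.erase s(u, w), ?_, Finset.insert_erase he⟩
      rw [mem_matchingsIn]
      refine ⟨fun e' he' => ?_, hM.2.mono (by simp)⟩
      obtain ⟨hne, he'⟩ := Finset.mem_erase.1 he'
      refine ⟨(hM.1 _ he').1, fun v hv => ?_⟩
      have hv' := hM.2 he' he hne v hv
      simp only [Sym2.mem_iff, not_or] at hv'
      simp [hv'.1, hv'.2, (hM.1 _ he').2 v hv]
    · left
      push Not at h
      rw [mem_matchingsIn]
      refine ⟨fun e he => ⟨(hM.1 e he).1, fun v hv => Finset.mem_erase.2
        ⟨?_, (hM.1 e he).2 v hv⟩⟩, hM.2⟩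
      rintro rfl
      exact h e he hv
  · rintro (hM | ⟨w, ⟨hw, hadj⟩, M, hM, rfl⟩)
    · rw [mem_matchingsIn] at hM ⊢
      exact ⟨fun e he => ⟨(hM.1 e he).1, fun v hv =>
        Finset.mem_of_mem_erase ((hM.1 e he).2 v hv)⟩, hM.2⟩
    · rw [mem_matchingsIn] at hM ⊢
      have hav : ∀ e ∈ M, ∀ v ∈ e, v ≠ u ∧ v ≠ w := by
        intro e he v hv
        have := (hM.1 e he).2 v hv
        simp only [Finset.mem_erase] at this
        tauto
      constructor
      · intro e he
        rcases Finset.mem_insert.1 he with rfl | he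
        · refine ⟨hadj, fun v hv => ?_⟩
          rcases Sym2.mem_iff.1 hv with rfl | rfl
          · exact hu
          · exact Finset.mem_of_mem_erase hw
        · exact ⟨(hM.1 e he).1, fun v hv =>
            Finset.mem_of_mem_erase (Finset.mem_of_mem_erase ((hM.1 e he).2 v hv))⟩
      · rw [Finset.coe_insert]
        refine hM.2.insert fun e he _ => ⟨fun v hv hv' => ?_, fun v hv hv' => ?_⟩
        · have := hav e he v hv'
          rcases Sym2.mem_iff.1 hv with h | h <;> tauto
        · have := hav e he v hv
          rcases Sym2.mem_iff.1 hv' with h | h <;> tauto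

/-- The vertex recurrence `μ(G) = x μ(G\u) - ∑_{w ~ u} μ(G\{u,w})`. -/
lemma matchingPolyIn_eq_sub_sum [DecidableRel G.Adj] {u : V} (hu : u ∈ S) :
    matchingPolyIn G S = X * matchingPolyIn G (S.erase u) -
      ∑ w ∈ (S.erase u).filter (G.Adj u), matchingPolyIn G ((S.erase u).erase w) := by
  have hnot {T : Finset V} (hT : u ∉ T) {M : Finset (Sym2 V)} (hM : M ∈ matchingsIn G T)
      (w : V) : s(u, w) ∉ M := fun h =>
    hT (((mem_matchingsIn.1 hM).1 _ h).2 u (by simp))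
  have hcard : (S.erase u).card + 1 = S.card := Finset.card_erase_add_one hu
  rw [matchingPolyIn, matchingsIn_eq_union hu, Finset.sum_union, Finset.sum_biUnion,
    sub_eq_add_neg, ← Finset.sum_neg_distrib]
  · congr 1
    · rw [matchingPolyIn, Finset.mul_sum]
      refine Finset.sum_congr rfl fun M hM => ?_
      have := two_mul_card_le_of_mem_matchingsIn hM
      rw [show S.card - 2 * M.card = (S.erase u).card - 2 * M.card + 1 by omega]
      ring
    · refine Finset.sum_congr rfl fun w hw => ?_
      have hw' := (Finset.mem_filter.1 hw).1
      have hcard' := Finset.card_erase_add_one hw'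
      rw [Finset.sum_image, matchingPolyIn, ← Finset.sum_neg_distrib]
      · refine Finset.sum_congr rfl fun M hM => ?_
        rw [Finset.card_insert_of_notMem (hnot (by simp) hM w),
          show S.card - 2 * (M.card + 1) = ((S.erase u).erase w).card - 2 * M.card by omega,
          pow_succ]
        simp
      · intro M hM M' hM' h
        rw [← Finset.erase_insert (hnot (by simp) hM w), h,
          Finset.erase_insert (hnot (by simp) hM' w)]
  · intro w hw w' hw' hne
    refine Finset.disjoint_left.2 fun N hN hN' => ?_
    obtain ⟨M, hM, rfl⟩ := Finset.mem_image.1 hN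
    obtain ⟨M', hM', h⟩ := Finset.mem_image.1 hN'
    have hmem : s(u, w) ∈ insert s(u, w') M' := h ▸ Finset.mem_insert_self _ _
    rcases Finset.mem_insert.1 hmem with h | h
    · exact hne (Sym2.congr_right.1 h)
    · exact hnot (by simp) hM' w h
  · refine Finset.disjoint_left.2 fun N hN hN' => ?_
    obtain ⟨w, hw, hN'⟩ := Finset.mem_biUnion.1 hN'
    obtain ⟨M, hM, rfl⟩ := Finset.mem_image.1 hN'
    exact hnot (by simp) hN w (Finset.mem_insert_self _ _)

lemma matchingPolyIn_union (hST : Disjoint S T) (hadj : ∀ a ∈ S, ∀ b ∈ T, ¬ G.Adj a b) :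
    matchingPolyIn G (S ∪ T) = matchingPolyIn G S * matchingPolyIn G T := by
  classical
  induction S using Finset.strongInduction with
  | H S ih =>
    rcases S.eq_empty_or_nonempty with rfl | ⟨u, hu⟩
    · simp [matchingPolyIn_empty]
    have huT : u ∉ T := Finset.disjoint_left.1 hST hu
    have ih' (R : Finset V) (hR : R ⊂ S) :=
      ih R hR (hST.mono_left hR.1) fun a ha => hadj a (hR.1 ha)
    have hsub : S.erase u ⊂ S := Finset.erase_ssubset hu
    have hfilter : ((S ∪ T).erase u).filter (G.Adj u) = (S.erase u).filter (G.Adj u) := by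
      ext w
      have := hadj u hu w
      simp only [Finset.mem_filter, Finset.mem_erase, Finset.mem_union]
      tauto
    rw [matchingPolyIn_eq_sub_sum (Finset.mem_union_left T hu), hfilter,
      matchingPolyIn_eq_sub_sum hu, Finset.erase_union_distrib, Finset.erase_eq_of_notMem huT,
      ih' _ hsub, sub_mul, Finset.sum_mul, mul_assoc]
    congr 1
    refine Finset.sum_congr rfl fun w hw => ?_
    have hwS := Finset.mem_of_mem_erase (Finset.mem_filter.1 hw).1
    rw [Finset.erase_union_distrib, Finset.erase_eq_of_notMem (Finset.disjoint_left.1 hST hwS),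
      ih' _ ((Finset.erase_subset _ _).trans_ssubset hsub)]

/-- Deleting a bridge `ab`: `μ(G) = μ(G₁) μ(G₂) - μ(G₁\a) μ(G₂\b)`. -/
lemma matchingPolyIn_union_of_bridge {a b : V} (hST : Disjoint S T) (ha : a ∈ S) (hb : b ∈ T)
    (hadj : ∀ x ∈ S, ∀ y ∈ T, G.Adj x y ↔ x = a ∧ y = b) :
    matchingPolyIn G (S ∪ T) = matchingPolyIn G S * matchingPolyIn G T -
      matchingPolyIn G (S.erase a) * matchingPolyIn G (T.erase b) := by
  classical
  have haT : a ∉ T := Finset.disjoint_left.1 hST ha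
  have hbS : b ∉ S := Finset.disjoint_right.1 hST hb
  have hunion (R Q : Finset V) (hR : R ⊆ S.erase a) (hQ : Q ⊆ T) :
      matchingPolyIn G (R ∪ Q) = matchingPolyIn G R * matchingPolyIn G Q :=
    matchingPolyIn_union ((hST.mono_left (hR.trans (Finset.erase_subset _ _))).mono_right hQ)
      fun x hx y hy h => (Finset.mem_erase.1 (hR hx)).1
        ((hadj x (Finset.mem_of_mem_erase (hR hx)) y (hQ hy)).1 h).1
  have hfilter : ((S ∪ T).erase a).filter (G.Adj a) =
      insert b ((S.erase a).filter (G.Adj a)) := by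
    ext w
    have := hadj a ha w
    have hba : b ≠ a := fun h => haT (h ▸ hb)
    simp only [Finset.mem_filter, Finset.mem_erase, Finset.mem_union, Finset.mem_insert]
    by_cases hwb : w = b
    · subst hwb; tauto
    · tauto
  rw [matchingPolyIn_eq_sub_sum (Finset.mem_union_left T ha), hfilter,
    Finset.sum_insert (by simp [hbS]), matchingPolyIn_eq_sub_sum ha,
    Finset.erase_union_distrib, Finset.erase_eq_of_notMem haT,
    hunion _ _ subset_rfl subset_rfl, Finset.erase_union_distrib,
    Finset.erase_eq_of_notMem (a := b) (s := S.erase a) (by simp [hbS]),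
    hunion _ _ subset_rfl (Finset.erase_subset _ _), sub_mul, Finset.sum_mul, mul_assoc,
    add_comm, ← sub_sub]
  congr 2
  refine Finset.sum_congr rfl fun w hw => ?_
  have hwS := Finset.mem_of_mem_erase (Finset.mem_filter.1 hw).1
  rw [Finset.erase_union_distrib, Finset.erase_eq_of_notMem (Finset.disjoint_left.1 hST hwS),
    hunion _ _ (Finset.erase_subset _ _) subset_rfl]

/-- The recurrence for the Wronskian of `μ(G\u)` and `μ(G)`. -/
lemma wronskian_matchingPolyIn_erase [DecidableRel G.Adj] {u : V} (hu : u ∈ S) :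
    wronskian (matchingPolyIn G (S.erase u)) (matchingPolyIn G S) =
      matchingPolyIn G (S.erase u) ^ 2 + ∑ w ∈ (S.erase u).filter (G.Adj u),
        wronskian (matchingPolyIn G ((S.erase u).erase w)) (matchingPolyIn G (S.erase u)) := by
  rw [matchingPolyIn_eq_sub_sum hu]
  simp only [wronskian, derivative_sub, derivative_mul, derivative_X, derivative_sum,
    Finset.sum_sub_distrib, ← Finset.sum_mul]
  ring

lemma matchingPolyIn_erase_sq_le_wronskian {u : V} (hu : u ∈ S) (θ : ℝ) :
    (matchingPolyIn G (S.erase u)).eval θ ^ 2 ≤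
      (wronskian (matchingPolyIn G (S.erase u)) (matchingPolyIn G S)).eval θ := by
  classical
  induction S using Finset.strongInduction generalizing u with
  | H S ih =>
    rw [wronskian_matchingPolyIn_erase hu, eval_add, eval_pow, eval_finsetSum]
    refine le_add_of_nonneg_right (Finset.sum_nonneg fun w hw => ?_)
    exact (sq_nonneg _).trans
      (ih _ (Finset.erase_ssubset hu) (Finset.mem_filter.1 hw).1)

lemma matchingPolyIn_ne_zero (G : SimpleGraph V) (S : Finset V) : matchingPolyIn G S ≠ 0 := by
  induction S using Finset.strongInduction with
  | H S ih =>
    rcases S.eq_empty_or_nonempty with rfl | ⟨u, hu⟩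
    · simp [matchingPolyIn_empty]
    intro h
    refine ih _ (Finset.erase_ssubset hu) (Polynomial.funext fun x => ?_)
    have := matchingPolyIn_erase_sq_le_wronskian (G := G) hu x
    rw [h] at this
    simpa using this.antisymm (by simpa using sq_nonneg _)

/-- If `θ` is a root of the Wronskian of `μ(G\u)` and `μ(G)`, then it is a root of `μ(G)`. -/
lemma isRoot_matchingPolyIn_of_isRoot_wronskian {u : V} (hu : u ∈ S) {θ : ℝ}
    (h : (wronskian (matchingPolyIn G (S.erase u)) (matchingPolyIn G S)).IsRoot θ) :
    (matchingPolyIn G S).IsRoot θ := by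
  classical
  have hle {w : V} (hw : w ∈ (S.erase u).filter (G.Adj u)) :=
    matchingPolyIn_erase_sq_le_wronskian (G := G) (Finset.mem_filter.1 hw).1 θ
  have hnonneg := fun w hw => (sq_nonneg _).trans (hle (w := w) hw)
  rw [IsRoot.def, wronskian_matchingPolyIn_erase hu, eval_add, eval_pow, eval_finsetSum,
    add_eq_zero_iff_of_nonneg (sq_nonneg _) (Finset.sum_nonneg hnonneg),
    Finset.sum_eq_zero_iff_of_nonneg hnonneg] at h
  rw [IsRoot.def, matchingPolyIn_eq_sub_sum hu, eval_sub, eval_mul, eval_finsetSum,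
    pow_eq_zero_iff two_ne_zero |>.1 h.1, mul_zero, zero_sub, neg_eq_zero]
  refine Finset.sum_eq_zero fun w hw => ?_
  exact pow_eq_zero_iff two_ne_zero |>.1 (((hle hw).trans_eq (h.2 w hw)).antisymm (sq_nonneg _))

lemma rootMultiplicity_matchingPolyIn_erase_le_one {u : V} (hu : u ∈ S) {θ : ℝ}
    (h : ¬ (matchingPolyIn G S).IsRoot θ) :
    (matchingPolyIn G (S.erase u)).rootMultiplicity θ ≤ 1 := by
  by_contra! hlt
  rw [one_lt_rootMultiplicity_iff_isRoot (matchingPolyIn_ne_zero G _)] at hlt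
  refine h (isRoot_matchingPolyIn_of_isRoot_wronskian hu ?_)
  have h0 := hlt.1
  have h1 := hlt.2
  rw [IsRoot.def] at h0 h1 ⊢
  simp [wronskian, h0, h1]

lemma isRoot_matchingPolyIn_erase_union_of_bridge {a b u : V} {θ : ℝ} (hST : Disjoint S T)
    (hb : b ∈ T) (hadj : ∀ x ∈ S, ∀ y ∈ T, G.Adj x y ↔ x = a ∧ y = b) (hu : u ∈ S) (ha : a ∈ S)
    (hSu : (matchingPolyIn G (S.erase u)).IsRoot θ)
    (hTb : (matchingPolyIn G (T.erase b)).IsRoot θ) :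
    (matchingPolyIn G ((S ∪ T).erase u)).IsRoot θ := by
  have hdisj : Disjoint (S.erase u) T := hST.mono_left (Finset.erase_subset _ _)
  rw [IsRoot.def] at *
  rw [Finset.erase_union_distrib, Finset.erase_eq_of_notMem (Finset.disjoint_left.1 hST hu)]
  by_cases hau : a = u
  · subst hau
    rw [matchingPolyIn_union hdisj fun x hx y hy h => (Finset.mem_erase.1 hx).1
      ((hadj x (Finset.mem_of_mem_erase hx) y hy).1 h).1, eval_mul, hSu, zero_mul]
  · rw [matchingPolyIn_union_of_bridge hdisj (Finset.mem_erase.2 ⟨hau, ha⟩) hb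
      fun x hx => hadj x (Finset.mem_of_mem_erase hx), eval_sub, eval_mul, eval_mul, hSu, hTb]
    simp

end Ambient

section Embedding

variable {W V : Type*} [Fintype W] [Fintype V] [DecidableEq V] {H : SimpleGraph W}
  {G : SimpleGraph V} {S : Finset V}

lemma matchingPoly_deleteVert_eq (f : H ↪g G) (hS : ∀ v, v ∈ S ↔ ∃ w, f w = v) (u : W) :
    matchingPoly (deleteVert H u) = matchingPolyIn G (S.erase (f u)) := by
  classical
  refine matchingPoly_eq_matchingPolyIn
    (f.comp (SimpleGraph.Embedding.induce (G := H) ({u}ᶜ : Set W))) fun v => ?_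
  rw [Finset.mem_erase, hS]
  constructor
  · rintro ⟨hne, w, rfl⟩
    exact ⟨⟨w, fun h => hne (congrArg f h)⟩, rfl⟩
  · rintro ⟨⟨w, hw⟩, rfl⟩
    exact ⟨fun h => hw (f.injective h), w, rfl⟩

lemma isSuperPositive_iff (f : H ↪g G) (hS : ∀ v, v ∈ S ↔ ∃ w, f w = v) (θ : ℝ) :
    IsSuperPositive θ H ↔ ¬ (matchingPolyIn G S).IsRoot θ ∧
      ∀ u ∈ S, (matchingPolyIn G (S.erase u)).rootMultiplicity θ = 1 := by
  have hS' : (∀ u ∈ S, (matchingPolyIn G (S.erase u)).rootMultiplicity θ = 1) ↔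
      ∀ w, (matchingPolyIn G (S.erase (f w))).rootMultiplicity θ = 1 := by
    simp [hS]
  simp only [IsSuperPositive, mult, matchingPoly_deleteVert_eq f hS,
    matchingPoly_eq_matchingPolyIn f hS, hS', rootMultiplicity_eq_zero_iff,
    matchingPolyIn_ne_zero, imp_false]

end Embedding

/-- Adding an edge between two θ-super positive graphs yields a θ-super positive graph. -/
theorem stmt_0 {V₁ V₂ : Type*} [Fintype V₁] [Fintype V₂] (θ : ℝ)
    (G₁ : SimpleGraph V₁) (G₂ : SimpleGraph V₂)
    (h₁ : IsSuperPositive θ G₁) (h₂ : IsSuperPositive θ G₂)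
    (v₁ : V₁) (v₂ : V₂) (G : SimpleGraph (V₁ ⊕ V₂))
    (hG : ∀ x y : V₁ ⊕ V₂, G.Adj x y ↔
      (∃ a b : V₁, x = Sum.inl a ∧ y = Sum.inl b ∧ G₁.Adj a b) ∨
      (∃ a b : V₂, x = Sum.inr a ∧ y = Sum.inr b ∧ G₂.Adj a b) ∨
      (x = Sum.inl v₁ ∧ y = Sum.inr v₂) ∨ (x = Sum.inr v₂ ∧ y = Sum.inl v₁)) :
    IsSuperPositive θ G := by
  classical
  let f₁ : G₁ ↪g G := ⟨Function.Embedding.inl, by simp [hG]⟩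
  let f₂ : G₂ ↪g G := ⟨Function.Embedding.inr, by simp [hG]⟩
  let A : Finset (V₁ ⊕ V₂) := Finset.univ.map f₁.toEmbedding
  let B : Finset (V₁ ⊕ V₂) := Finset.univ.map f₂.toEmbedding
  have hA : ∀ v, v ∈ A ↔ ∃ w, f₁ w = v := by simp [A]
  have hB : ∀ v, v ∈ B ↔ ∃ w, f₂ w = v := by simp [B]
  have hv₁ : f₁ v₁ ∈ A := (hA _).2 ⟨v₁, rfl⟩
  have hv₂ : f₂ v₂ ∈ B := (hB _).2 ⟨v₂, rfl⟩
  have hAB : Disjoint A B := by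
    refine Finset.disjoint_left.2 fun x hx hx' => ?_
    obtain ⟨a, rfl⟩ := (hA _).1 hx
    obtain ⟨b, hb⟩ := (hB _).1 hx'
    exact Sum.inr_ne_inl hb
  have huniv (x : V₁ ⊕ V₂) : x ∈ A ∪ B := by
    rcases x with a | b
    · exact Finset.mem_union_left _ ((hA _).2 ⟨a, rfl⟩)
    · exact Finset.mem_union_right _ ((hB _).2 ⟨b, rfl⟩)
  have hadj : ∀ x ∈ A, ∀ y ∈ B, G.Adj x y ↔ x = f₁ v₁ ∧ y = f₂ v₂ := by
    intro x hx y hy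
    obtain ⟨a, rfl⟩ := (hA _).1 hx
    obtain ⟨b, rfl⟩ := (hB _).1 hy
    change G.Adj (Sum.inl a) (Sum.inr b) ↔ Sum.inl a = Sum.inl v₁ ∧ Sum.inr b = Sum.inr v₂
    simp [hG]
  have hadj' : ∀ y ∈ B, ∀ x ∈ A, G.Adj y x ↔ y = f₂ v₂ ∧ x = f₁ v₁ := fun y hy x hx => by
    rw [G.adj_comm, hadj x hx y hy, and_comm]
  rw [isSuperPositive_iff f₁ hA] at h₁
  rw [isSuperPositive_iff f₂ hB] at h₂
  rw [isSuperPositive_iff (SimpleGraph.Embedding.refl (G := G)) (S := A ∪ B)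
    fun v => by simp [huniv v]]
  have hroot {p : ℝ[X]} (hp : p.rootMultiplicity θ = 1) : p.IsRoot θ :=
    (rootMultiplicity_pos'.1 (hp ▸ one_pos)).2
  have hrootA := fun u hu => hroot (h₁.2 u hu)
  have hrootB := fun u hu => hroot (h₂.2 u hu)
  have hne : ¬ (matchingPolyIn G (A ∪ B)).IsRoot θ := by
    have h0 := hrootA _ hv₁
    rw [IsRoot.def] at h0 ⊢
    rw [matchingPolyIn_union_of_bridge hAB hv₁ hv₂ hadj, eval_sub, eval_mul, eval_mul, h0,
      zero_mul, sub_zero]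
    exact mul_ne_zero h₁.1 h₂.1
  refine ⟨hne, fun u hu => (rootMultiplicity_matchingPolyIn_erase_le_one hu hne).antisymm ?_⟩
  refine (rootMultiplicity_pos (matchingPolyIn_ne_zero G _)).2 ?_
  rcases Finset.mem_union.1 hu with hu | hu
  · exact isRoot_matchingPolyIn_erase_union_of_bridge hAB hv₂ hadj hu hv₁ (hrootA u hu)
      (hrootB _ hv₂)
  · rw [Finset.union_comm]
    exact isRoot_matchingPolyIn_erase_union_of_bridge hAB.symm hv₁ hadj' hu hv₂ (hrootB u hu)
      (hrootA _ hv₁)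

end MatchPoly
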